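/- For every n ≥ 1 and every T ∈ Mₙ, there exists a unique diagonal matrix D ∈ 𝒟ₙ that is a best coapproximation to T out of 𝒟ₙ with respect to the operator norm; that is, 𝒟ₙ is a co-Chebyshev subspace of Mₙ. -/

import Mathlib

/-- The operator norm of an `n × n` real matrix, induced by the Euclidean norm on `ℝⁿ`. -/
noncomputable def opNorm {n : ℕ} (A : Matrix (Fin n) (Fin n) ℝ) : ℝ :=
  ‖LinearMap.toContinuousLinearMap (Matrix.toEuclideanLin A)‖

open scoped InnerProductSpace in
/-- A rank-one perturbation `L + s e eᵀ` has norm `|s| + sign s * ⟪e, L e⟫ + O(1 / |s|)`. -/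
theorem norm_add_smul_rankOne_sq_le {H : Type*} [NormedAddCommGroup H] [InnerProductSpace ℝ H]
    (L : H →L[ℝ] H) {e : H} (he : ‖e‖ = 1) {s : ℝ} (hs : 4 * ‖L‖ ≤ |s|) :
    ‖L + s • InnerProductSpace.rankOne ℝ e e‖ ^ 2 ≤ s ^ 2 + 2 * s * ⟪e, L e⟫_ℝ + 3 * ‖L‖ ^ 2 := by
  set M := ‖L‖
  set t := ⟪e, L e⟫_ℝ
  have hM : 0 ≤ M := norm_nonneg L
  have hinner (z : H) : |⟪e, L z⟫_ℝ| ≤ M * ‖z‖ := by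
    have h := abs_real_inner_le_norm e (L z)
    rw [he, one_mul] at h
    exact h.trans (L.le_opNorm z)
  have ht : |t| ≤ M := by simpa [he] using hinner e
  have hst : 0 ≤ s ^ 2 / 2 + 2 * (s * t) := by
    have h₁ : |s * t| ≤ |s| * M := by rw [abs_mul]; gcongr
    have h₂ := neg_abs_le (s * t)
    nlinarith [sq_abs s, abs_nonneg s]
  have hc : 0 ≤ s ^ 2 + 2 * s * t + 3 * M ^ 2 := by nlinarith [sq_nonneg s, sq_nonneg M]
  refine (Real.le_sqrt (norm_nonneg _) hc).1 ?_
  refine ContinuousLinearMap.opNorm_le_bound _ (Real.sqrt_nonneg _) fun x => ?_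
  refine le_of_sq_le_sq ?_ (by positivity)
  rw [mul_pow, Real.sq_sqrt hc]
  obtain ⟨a, ha⟩ : ∃ a, a = ⟪e, x⟫_ℝ := ⟨_, rfl⟩
  obtain ⟨y, hy⟩ : ∃ y, y = x - a • e := ⟨_, rfl⟩
  have hx : x = a • e + y := by rw [hy]; abel
  have hey : ⟪e, y⟫_ℝ = 0 := by
    rw [hy, inner_sub_right, inner_smul_right, real_inner_self_eq_norm_sq, he, ← ha]; ring
  have hnx : ‖x‖ ^ 2 = a ^ 2 + ‖y‖ ^ 2 := by
    rw [hx, norm_add_sq_real, inner_smul_left, hey, norm_smul, he, mul_one, Real.norm_eq_abs,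
      sq_abs]
    simp
  have hLx : ⟪e, L x⟫_ℝ = a * t + ⟪e, L y⟫_ℝ := by
    rw [hx, map_add, map_smul, inner_add_right, inner_smul_right]
  have happ : (L + s • InnerProductSpace.rankOne ℝ e e) x = L x + (s * a) • e := by
    simp [ha, smul_smul]
  have hexp : ‖L x + (s * a) • e‖ ^ 2
      = ‖L x‖ ^ 2 + 2 * (s * a) * (a * t + ⟪e, L y⟫_ℝ) + s ^ 2 * a ^ 2 := by
    rw [norm_add_sq_real, inner_smul_right, real_inner_comm, hLx, norm_smul, he, mul_one,
      Real.norm_eq_abs, sq_abs]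
    ring
  have hbound : ‖L x‖ ^ 2 ≤ M ^ 2 * (a ^ 2 + ‖y‖ ^ 2) := by
    rw [← hnx, ← mul_pow]
    gcongr
    exact L.le_opNorm x
  have hr : ⟪e, L y⟫_ℝ ^ 2 ≤ M ^ 2 * ‖y‖ ^ 2 := by
    rw [← mul_pow, ← sq_abs]
    gcongr
    exact hinner y
  have hcross : 2 * (s * a) * ⟪e, L y⟫_ℝ ≤ 2 * M ^ 2 * a ^ 2 + s ^ 2 * ‖y‖ ^ 2 / 2 := by
    have h₁ : |s * a * ⟪e, L y⟫_ℝ| ≤ |s| * |a| * (M * ‖y‖) := by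
      rw [abs_mul, abs_mul]
      gcongr
      exact hinner y
    have h₂ := le_abs_self (s * a * ⟪e, L y⟫_ℝ)
    nlinarith [sq_nonneg (2 * M * |a| - |s| * ‖y‖), sq_abs s, sq_abs a]
  rw [happ, hexp, hnx]
  nlinarith [mul_nonneg hst (sq_nonneg ‖y‖), mul_nonneg (sq_nonneg M) (sq_nonneg ‖y‖)]

open scoped InnerProductSpace in
theorem eq_inner_of_forall_abs_add_le_norm {H : Type*} [NormedAddCommGroup H]
    [InnerProductSpace ℝ H] (L : H →L[ℝ] H) {e : H} (he : ‖e‖ = 1) {d : ℝ}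
    (h : ∀ s : ℝ, |d + s| ≤ ‖L + s • InnerProductSpace.rankOne ℝ e e‖) : d = ⟪e, L e⟫_ℝ := by
  by_contra hne
  obtain ⟨u, hu⟩ : ∃ u, u = d - ⟪e, L e⟫_ℝ := ⟨_, rfl⟩
  have hu0 : u ≠ 0 := hu ▸ sub_ne_zero.2 hne
  have hu1 : 0 < |u| := abs_pos.2 hu0
  obtain ⟨k, hk⟩ : ∃ k, k = 4 * ‖L‖ / |u| + (3 * ‖L‖ ^ 2 + 1) / u ^ 2 := ⟨_, rfl⟩
  have hk0 : 0 ≤ k := by rw [hk]; positivity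
  have hs : 4 * ‖L‖ ≤ |k * u| := by
    rw [abs_mul, abs_of_nonneg hk0, ← div_le_iff₀ hu1, hk]
    exact le_add_of_nonneg_right (by positivity)
  have hlarge : 3 * ‖L‖ ^ 2 + 1 ≤ k * u ^ 2 := by
    rw [← div_le_iff₀ (by positivity), hk]
    exact le_add_of_nonneg_left (by positivity)
  have hle := norm_add_smul_rankOne_sq_le L he hs
  have hsq : (d + k * u) ^ 2 ≤ ‖L + (k * u) • InnerProductSpace.rankOne ℝ e e‖ ^ 2 := by
    rw [← sq_abs]
    gcongr
    exact h _
  have hd : ⟪e, L e⟫_ℝ = d - u := by rw [hu]; ring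
  rw [hd] at hle
  nlinarith [sq_nonneg d, sq_nonneg ‖L‖]

open scoped InnerProductSpace in
theorem inner_single_toEuclideanLin_single {n : ℕ} (A : Matrix (Fin n) (Fin n) ℝ) (i : Fin n) :
    ⟪EuclideanSpace.single i (1 : ℝ), Matrix.toEuclideanLin A (EuclideanSpace.single i 1)⟫_ℝ
      = A i i := by
  simp [EuclideanSpace.inner_single_left]

theorem abs_apply_self_le_opNorm {n : ℕ} (A : Matrix (Fin n) (Fin n) ℝ) (i : Fin n) :
    |A i i| ≤ opNorm A := by
  rw [← inner_single_toEuclideanLin_single A i]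
  refine (abs_real_inner_le_norm _ _).trans ?_
  have h := (LinearMap.toContinuousLinearMap (Matrix.toEuclideanLin A)).le_opNorm
    (EuclideanSpace.single i 1)
  simpa [opNorm] using h

open scoped Matrix.Norms.L2Operator in
theorem opNorm_diagonal {n : ℕ} (v : Fin n → ℝ) : opNorm (Matrix.diagonal v) = ‖v‖ :=
  Matrix.l2_opNorm_diagonal v

theorem toContinuousLinearMap_toEuclideanLin_add_single {n : ℕ} (A : Matrix (Fin n) (Fin n) ℝ)
    (i : Fin n) (s : ℝ) :
    LinearMap.toContinuousLinearMap (Matrix.toEuclideanLin (A + Matrix.diagonal (Pi.single i s)))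
      = LinearMap.toContinuousLinearMap (Matrix.toEuclideanLin A) + s •
        InnerProductSpace.rankOne ℝ (EuclideanSpace.single i (1 : ℝ))
          (EuclideanSpace.single i (1 : ℝ)) := by
  ext x j
  by_cases hj : j = i
  · subst hj
    simp [Matrix.mulVec_diagonal, EuclideanSpace.inner_single_left]
  · simp [Matrix.mulVec_diagonal, EuclideanSpace.inner_single_left, hj]

/-- `𝒟ₙ` is a co-Chebyshev subspace of `Mₙ`: every matrix has a unique best
coapproximation out of the diagonal matrices. -/
theorem diagonal_coChebyshev (n : ℕ) (hn : 0 < n) (T : Matrix (Fin n) (Fin n) ℝ) :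
    ∃! D : Matrix (Fin n) (Fin n) ℝ, D.IsDiag ∧
      ∀ C : Matrix (Fin n) (Fin n) ℝ, C.IsDiag → opNorm (D - C) ≤ opNorm (T - C) := by
  refine ⟨Matrix.diagonal T.diag, ⟨Matrix.isDiag_diagonal _, fun C hC => ?_⟩, fun D hD => ?_⟩
  · rw [← hC.diagonal_diag, Matrix.diagonal_sub, opNorm_diagonal, hC.diagonal_diag,
      pi_norm_le_iff_of_nonneg (by exact norm_nonneg _)]
    exact fun i => abs_apply_self_le_opNorm (T - C) i
  · obtain ⟨hdiag, hD⟩ := hD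
    rw [← hdiag.diagonal_diag]
    congr 1
    ext i
    refine (eq_inner_of_forall_abs_add_le_norm
      (LinearMap.toContinuousLinearMap (Matrix.toEuclideanLin T))
      (e := EuclideanSpace.single i (1 : ℝ)) (by simp) fun s => ?_).trans
      (inner_single_toEuclideanLin_single T i)
    rw [← toContinuousLinearMap_toEuclideanLin_add_single]
    have h := hD (-Matrix.diagonal (Pi.single i s)) (Matrix.isDiag_diagonal _).neg
    rw [sub_neg_eq_add, sub_neg_eq_add] at h
    refine le_trans ?_ h
    simpa using abs_apply_self_le_opNorm (D + Matrix.diagonal (Pi.single i s)) i
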